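/- The assignment γ_i ↦ S_i (for i ∈ 𝓘) induces a group isomorphism from the Weyl group W(Γ) of the valued graph Γ onto C_G(W(Q)), the subgroup of the Weyl group W(Q) consisting of all elements that commute with the G-action on ℤI. -/

import Mathlib

/-!
STATEMENT 2: The assignment `γ_i ↦ S_i` (for `i ∈ 𝓘`) induces a group isomorphism from the
Weyl group `W(Γ)` of the valued graph `Γ` onto `C_G(W(Q))`, the subgroup of the Weyl group
`W(Q)` consisting of all elements commuting with the `G`-action on `ℤI`.
-/

open Finset

section McKayLattice

variable (G : Type) [Group G] [Fintype G]
variable {I : Type} [Fintype I] [DecidableEq I]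

/-- The orbit of a vertex under the `G`-action, as a `Finset`. -/
def orbitF [MulAction G I] (i : I) : Finset I := Finset.univ.image (fun g : G => g • i)

/-- `d_i`, the size of the orbit of the vertex `i`. -/
def dOrb [MulAction G I] (i : I) : ℕ := (orbitF G i).card

/-- The entries of the (symmetric) Cartan matrix of the quiver `Q`, where `n i j` is the
number of edges between the vertices `i` and `j`:  `a i i = 2`, `a i j = -(n i j)` else. -/
def aMat (n : I → I → ℕ) (i j : I) : ℤ := if i = j then 2 else -(n i j : ℤ)

/-- The symmetric bilinear form `(-,-)_Q` on the root lattice `ℤI`,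
determined by `(ε_i, ε_j)_Q = a i j`. -/
def pairQ (n : I → I → ℕ) (α β : I → ℤ) : ℤ := ∑ i, ∑ j, aMat n i j * α i * β j

/-- The simple root `ε_i` in the root lattice. -/
def eps (i : I) : I → ℤ := Pi.single i 1

/-- The action of `g ∈ G` on the root lattice `ℤI`, given by `g (ε_i) = ε_{g i}`. -/
def gact [MulAction G I] (g : G) (α : I → ℤ) : I → ℤ := fun i => α (g⁻¹ • i)

variable {ι : Type} [Fintype ι] [DecidableEq ι]

/-- The symmetric matrix `B` of the valued graph `Γ` of `(Q, G)`, indexed by the set `𝓘` of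
orbit representatives `rep : ι → I`:  `b k k = 2 d_k`, and for `k ≠ l`,
`b k l = -(number of edges between the orbits 𝒪_k and 𝒪_l)`. -/
def bMat [MulAction G I] (n : I → I → ℕ) (rep : ι → I) (k l : ι) : ℤ :=
  if k = l then 2 * (dOrb G (rep k) : ℤ)
  else -(∑ i ∈ orbitF G (rep k), ∑ j ∈ orbitF G (rep l), (n i j : ℤ))

/-- The bilinear form on the root lattice `ℤ𝓘` of a valued graph determined by a symmetric
matrix `b`, via `(ε̄_k, ε̄_l)_Γ = b k l`. -/
def pairV (b : ι → ι → ℤ) (x y : ι → ℤ) : ℤ := ∑ k, ∑ l, b k l * x k * y l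

/-- The canonical map `f : (ℤI)^G → ℤ𝓘`, `f (Σ α_i ε_i) = Σ_{k ∈ 𝓘} α_{rep k} ε̄_k`. -/
def fmap (rep : ι → I) (α : I → ℤ) : ι → ℤ := fun k => α (rep k)

end McKayLattice

section Reflections

variable (G : Type) [Group G] [Fintype G]
variable {I : Type} [Fintype I] [DecidableEq I]
variable {ι : Type} [Fintype ι] [DecidableEq ι]

/-- The reflection `γ_k : α ↦ α - (1/d_k) (α, ε̄_k)_Γ ε̄_k` on the root lattice `ℤ𝓘` of the
valued graph `Γ` of `(Q, G)`. -/
def gammaRef [MulAction G I] (n : I → I → ℕ) (rep : ι → I) (k : ι) (x : ι → ℤ) : ι → ℤ :=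
  x - (pairV (bMat G n rep) x (eps k) / (dOrb G (rep k) : ℤ)) • eps k

end Reflections

section WordLength

variable {κ M : Type*}

/-- The length of a shortest word in the letters `f` representing `w` (`0` if there is none). -/
noncomputable def wordLength [Monoid M] (f : κ → M) (w : M) : ℕ :=
  sInf {m | ∃ L : List κ, L.length = m ∧ (L.map f).prod = w}

theorem wordLength_prod_le [Monoid M] (f : κ → M) (L : List κ) :
    wordLength f (L.map f).prod ≤ L.length :=
  Nat.sInf_le ⟨L, rfl, rfl⟩

variable [Group M] {f : κ → M}

theorem exists_word_of_mem_closure (hf : ∀ i, f i * f i = 1) {w : M}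
    (hw : w ∈ Subgroup.closure (Set.range f)) : ∃ L : List κ, (L.map f).prod = w := by
  induction hw using Subgroup.closure_induction with
  | mem x hx =>
    obtain ⟨i, rfl⟩ := hx
    exact ⟨[i], by simp⟩
  | one => exact ⟨[], rfl⟩
  | mul x y _ _ hx hy =>
    obtain ⟨L, rfl⟩ := hx
    obtain ⟨L', rfl⟩ := hy
    exact ⟨L ++ L', by simp⟩
  | inv x _ hx =>
    obtain ⟨L, rfl⟩ := hx
    have hinv : (fun i => (f i)⁻¹) = f := funext fun i => inv_eq_of_mul_eq_one_left (hf i)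
    refine ⟨L.reverse, ?_⟩
    rw [List.prod_inv_reverse, List.map_map, List.map_reverse]
    congr 3
    exact hinv.symm

theorem exists_minimal_word (hf : ∀ i, f i * f i = 1) {w : M}
    (hw : w ∈ Subgroup.closure (Set.range f)) :
    ∃ L : List κ, L.length = wordLength f w ∧ (L.map f).prod = w := by
  obtain ⟨L, hL⟩ := exists_word_of_mem_closure hf hw
  exact Nat.sInf_mem (s := {m | ∃ L : List κ, L.length = m ∧ (L.map f).prod = w}) ⟨_, L, rfl, hL⟩

theorem wordLength_mul_le (hf : ∀ i, f i * f i = 1) {w : M}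
    (hw : w ∈ Subgroup.closure (Set.range f)) (i : κ) :
    wordLength f (w * f i) ≤ wordLength f w + 1 := by
  obtain ⟨L, hL, rfl⟩ := exists_minimal_word hf hw
  simpa [← hL] using wordLength_prod_le f (L ++ [i])

theorem wordLength_le_mul (hf : ∀ i, f i * f i = 1) {w : M}
    (hw : w ∈ Subgroup.closure (Set.range f)) (i : κ) :
    wordLength f w ≤ wordLength f (w * f i) + 1 := by
  have := wordLength_mul_le hf (mul_mem hw (Subgroup.subset_closure ⟨i, rfl⟩)) i
  rwa [mul_assoc, hf, mul_one] at this

theorem exists_wordLength_mul_lt (hf : ∀ i, f i * f i = 1) {w : M}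
    (hw : w ∈ Subgroup.closure (Set.range f)) (h1 : w ≠ 1) :
    ∃ i, wordLength f (w * f i) < wordLength f w := by
  obtain ⟨L, hL, rfl⟩ := exists_minimal_word hf hw
  rcases List.eq_nil_or_concat L with rfl | ⟨L', i, rfl⟩
  · exact absurd rfl h1
  · refine ⟨i, ?_⟩
    rw [← hL]
    have := wordLength_prod_le f L'
    simp only [List.concat_eq_append, List.map_append, List.prod_append, List.map_cons,
      List.map_nil, List.prod_singleton, mul_assoc, hf, mul_one, List.length_append,
      List.length_singleton]
    omega

end WordLength

section SimpleReflections

variable {I : Type} [DecidableEq I]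

theorem aMat_self (n : I → I → ℕ) (i : I) : aMat n i i = 2 := if_pos rfl

theorem aMat_of_ne (n : I → I → ℕ) {i j : I} (h : i ≠ j) : aMat n i j = -(n i j : ℤ) := if_neg h

theorem eps_nonneg (i : I) : 0 ≤ (eps i : I → ℤ) := by
  simp [eps]

theorem eps_ne_zero (i : I) : (eps i : I → ℤ) ≠ 0 := by
  simp [eps]

variable [Fintype I] {n : I → I → ℕ} {r : I → Equiv.Perm (I → ℤ)}

theorem pairQ_eps (n : I → I → ℕ) (α : I → ℤ) (i : I) :
    pairQ n α (eps i) = ∑ j, aMat n j i * α j := by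
  simp [pairQ, eps, Pi.single_apply]

theorem pairQ_eps_eps (n : I → I → ℕ) (i j : I) : pairQ n (eps j) (eps i) = aMat n j i := by
  rw [pairQ_eps]
  simp [eps, Pi.single_apply]

theorem pairQ_sub_left (n : I → I → ℕ) (α β γ : I → ℤ) :
    pairQ n (α - β) γ = pairQ n α γ - pairQ n β γ := by
  simp [pairQ, ← Finset.sum_sub_distrib, mul_sub, sub_mul]

theorem pairQ_smul_left (n : I → I → ℕ) (c : ℤ) (α γ : I → ℤ) :
    pairQ n (c • α) γ = c * pairQ n α γ := by
  simp only [pairQ, Finset.mul_sum, Pi.smul_apply, smul_eq_mul]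
  exact Finset.sum_congr rfl fun _ _ => Finset.sum_congr rfl fun _ _ => by ring

theorem pairQ_add_left (n : I → I → ℕ) (α β γ : I → ℤ) :
    pairQ n (α + β) γ = pairQ n α γ + pairQ n β γ := by
  simp [pairQ, ← Finset.sum_add_distrib, mul_add, add_mul]

theorem pairQ_sum_left {κ : Type*} (n : I → I → ℕ) (T : Finset κ) (α : κ → I → ℤ) (γ : I → ℤ) :
    pairQ n (∑ i ∈ T, α i) γ = ∑ i ∈ T, pairQ n (α i) γ := by
  classical
  induction T using Finset.induction_on with
  | empty => simp [pairQ]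
  | insert a T ha ih => rw [Finset.sum_insert ha, Finset.sum_insert ha, pairQ_add_left, ih]

theorem reflection_mul_self (hr : ∀ (i : I) (α : I → ℤ), r i α = α - pairQ n α (eps i) • eps i)
    (i : I) : r i * r i = 1 := by
  ext1 α
  simp only [Equiv.Perm.mul_apply, hr, Equiv.Perm.one_apply, pairQ_sub_left, pairQ_smul_left,
    pairQ_eps_eps, aMat_self]
  module

theorem reflection_eps_self (hr : ∀ (i : I) (α : I → ℤ), r i α = α - pairQ n α (eps i) • eps i)
    (i : I) : r i (eps i) = -eps i := by
  rw [hr, pairQ_eps_eps, aMat_self]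
  module

theorem reflection_eps_of_ne (hr : ∀ (i : I) (α : I → ℤ), r i α = α - pairQ n α (eps i) • eps i)
    {i j : I} (h : j ≠ i) : r i (eps j) = eps j + (n j i : ℤ) • eps i := by
  rw [hr, pairQ_eps_eps, aMat_of_ne n h]
  module

theorem reflection_comm (hr : ∀ (i : I) (α : I → ℤ), r i α = α - pairQ n α (eps i) • eps i)
    (hsymm : ∀ i j, n i j = n j i) {s t : I} (hst : s ≠ t) (h : n s t = 0) :
    r s * r t = r t * r s := by
  ext1 α
  have h' : n t s = 0 := hsymm t s ▸ h
  simp only [Equiv.Perm.mul_apply, hr, pairQ_sub_left, pairQ_smul_left,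
    pairQ_eps_eps, aMat_of_ne n hst, aMat_of_ne n hst.symm, h, h']
  push_cast
  module

theorem reflection_braid (hr : ∀ (i : I) (α : I → ℤ), r i α = α - pairQ n α (eps i) • eps i)
    (hsymm : ∀ i j, n i j = n j i) {s t : I} (hst : s ≠ t) (h : n s t = 1) :
    r s * r t * r s = r t * r s * r t := by
  ext1 α
  have h' : n t s = 1 := hsymm t s ▸ h
  simp only [Equiv.Perm.mul_apply, hr, pairQ_sub_left, pairQ_smul_left,
    pairQ_eps_eps, aMat_of_ne n hst, aMat_of_ne n hst.symm, aMat_self, h, h']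
  push_cast
  module

theorem map_smul_add_smul_of_mem_closure
    (hr : ∀ (i : I) (α : I → ℤ), r i α = α - pairQ n α (eps i) • eps i)
    {w : Equiv.Perm (I → ℤ)} (hw : w ∈ Subgroup.closure (Set.range r)) (p q : ℤ) (x y : I → ℤ) :
    w (p • x + q • y) = p • w x + q • w y := by
  induction hw using Subgroup.closure_induction generalizing x y with
  | mem w hw =>
    obtain ⟨i, rfl⟩ := hw
    simp only [hr, pairQ_add_left, pairQ_smul_left]
    module
  | one => rfl
  | mul w w' _ _ hw hw' => simp only [Equiv.Perm.mul_apply, hw, hw']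
  | inv w _ hw => rw [Equiv.Perm.inv_eq_iff_eq, hw]; simp

theorem map_zero_of_mem_closure
    (hr : ∀ (i : I) (α : I → ℤ), r i α = α - pairQ n α (eps i) • eps i)
    {w : Equiv.Perm (I → ℤ)} (hw : w ∈ Subgroup.closure (Set.range r)) : w 0 = 0 := by
  simpa using map_smul_add_smul_of_mem_closure hr hw 0 0 0 0

theorem map_neg_of_mem_closure
    (hr : ∀ (i : I) (α : I → ℤ), r i α = α - pairQ n α (eps i) • eps i)
    {w : Equiv.Perm (I → ℤ)} (hw : w ∈ Subgroup.closure (Set.range r)) (x : I → ℤ) :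
    w (-x) = -w x := by
  simpa using map_smul_add_smul_of_mem_closure hr hw (-1) 0 x 0

theorem map_sum_of_mem_closure
    (hr : ∀ (i : I) (α : I → ℤ), r i α = α - pairQ n α (eps i) • eps i)
    {w : Equiv.Perm (I → ℤ)} (hw : w ∈ Subgroup.closure (Set.range r)) (T : Finset I)
    (x : I → I → ℤ) : w (∑ i ∈ T, x i) = ∑ i ∈ T, w (x i) := by
  induction T using Finset.induction_on with
  | empty => simpa using map_zero_of_mem_closure hr hw
  | insert a T ha ih =>
    rw [Finset.sum_insert ha, Finset.sum_insert ha, ← ih]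
    simpa using map_smul_add_smul_of_mem_closure hr hw 1 1 (x a) (∑ i ∈ T, x i)

/-- If right multiplication by `r s` does not shorten `w`, then `w` sends `ε_s` to a nonnegative
vector; and if moreover `s` and `t` generate an infinite dihedral group, it does the same with
`p ε_s + q ε_t` for `0 ≤ q ≤ p`. The second part drives the induction. -/
theorem map_eps_nonneg_aux (hr : ∀ (i : I) (α : I → ℤ), r i α = α - pairQ n α (eps i) • eps i)
    (hsymm : ∀ i j, n i j = n j i) (N : ℕ) :
    ∀ w ∈ Subgroup.closure (Set.range r), wordLength r w = N →
      ∀ s, wordLength r w ≤ wordLength r (w * r s) →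
        0 ≤ w (eps s) ∧ ∀ t, 2 ≤ n s t → ∀ p q : ℤ, 0 ≤ q → q ≤ p →
          0 ≤ w (p • eps s + q • eps t) := by
  have hinv := reflection_mul_self hr
  induction N using Nat.strong_induction_on with
  | _ N ih =>
  intro w hw hN
  -- a right descent `t` of `w`, and the shorter element `w * r t`
  have descend : ∀ w' ∈ Subgroup.closure (Set.range r), ∀ t,
      wordLength r (w' * r t) < wordLength r w' →
      w' * r t ∈ Subgroup.closure (Set.range r) ∧
        wordLength r w' = wordLength r (w' * r t) + 1 ∧
        w' * r t * r t = w' := by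
    intro w' hw' t ht
    exact ⟨mul_mem hw' (Subgroup.subset_closure ⟨t, rfl⟩),
      le_antisymm (wordLength_le_mul hinv hw' t) ht, by rw [mul_assoc, hinv, mul_one]⟩
  have hfirst : ∀ s, wordLength r w ≤ wordLength r (w * r s) → 0 ≤ w (eps s) := by
    intro s hs
    by_cases h1 : w = 1
    · subst h1
      exact eps_nonneg s
    obtain ⟨t, ht⟩ := exists_wordLength_mul_lt hinv hw h1
    have hst : s ≠ t := by
      rintro rfl
      omega
    obtain ⟨hw₁, hl₁, hwt⟩ := descend w hw t ht
    generalize hw₁def : w * r t = w₁ at *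
    have hlt : wordLength r w₁ ≤ wordLength r (w₁ * r t) := by
      rw [hwt]
      omega
    have hval : w (eps s) = w₁ (eps s + (n s t : ℤ) • eps t) := by
      rw [← hwt, Equiv.Perm.mul_apply, reflection_eps_of_ne hr hst]
    rcases Nat.lt_or_ge (n s t) 2 with hlt2 | h2
    · have hcases : n s t = 0 ∨ n s t = 1 := by omega
      have hws := mul_mem hw (Subgroup.subset_closure (Set.mem_range_self (f := r) s))
      rcases hcases with h0 | h1'
      · have hcomm := reflection_comm hr hsymm hst h0
        have hle := wordLength_le_mul hinv hws t
        rw [mul_assoc, hcomm, ← mul_assoc, hw₁def] at hle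
        have := (ih _ (by omega) w₁ hw₁ rfl s (by omega)).1
        rw [hval, h0]
        simpa using this
      · by_cases hs₁ : wordLength r w₁ ≤ wordLength r (w₁ * r s)
        · have hps := (ih _ (by omega) w₁ hw₁ rfl s hs₁).1
          have hpt := (ih _ (by omega) w₁ hw₁ rfl t hlt).1
          have := map_smul_add_smul_of_mem_closure hr hw₁ 1 1 (eps s) (eps t)
          rw [hval, h1']
          simp only [one_smul, Nat.cast_one] at this ⊢
          rw [this]
          exact add_nonneg hps hpt
        · obtain ⟨hw₂, hl₂, hws₁⟩ := descend w₁ hw₁ s (by omega)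
          have hle₁ := wordLength_le_mul hinv hws t
          have hle₂ := wordLength_le_mul hinv
            (mul_mem hws (Subgroup.subset_closure (Set.mem_range_self (f := r) t))) s
          have hbraid : w * r s * r t * r s = w₁ * r s * r t := by
            rw [← hw₁def, mul_assoc, mul_assoc, ← mul_assoc (r s),
              reflection_braid hr hsymm hst h1']
            simp only [mul_assoc]
          rw [hbraid] at hle₂
          have := (ih _ (by omega) _ hw₂ rfl t (by omega)).1
          have hst' : n t s = 1 := hsymm t s ▸ h1'
          have hrs : r s (eps s + eps t) = eps t := by
            rw [hr, pairQ_add_left, pairQ_eps_eps, pairQ_eps_eps, aMat_self,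
              aMat_of_ne n hst.symm, hst']
            push_cast
            module
          rw [hval, ← hws₁, Equiv.Perm.mul_apply, h1', Nat.cast_one, one_smul, hrs]
          exact this
    · have h2' : 2 ≤ n t s := hsymm t s ▸ h2
      have := (ih _ (by omega) w₁ hw₁ rfl t hlt).2 s h2' (n s t) 1 (by norm_num) (by omega)
      rw [hval]
      convert this using 2
      module
  intro s hs
  refine ⟨hfirst s hs, fun t h2 p q hq hqp => ?_⟩
  by_cases ht : wordLength r w ≤ wordLength r (w * r t)
  · rw [map_smul_add_smul_of_mem_closure hr hw]
    exact add_nonneg (smul_nonneg (hq.trans hqp) (hfirst s hs)) (smul_nonneg hq (hfirst t ht))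
  have hst : s ≠ t := by
    rintro rfl
    exact ht hs
  obtain ⟨hw₁, hl₁, hwt⟩ := descend w hw t (by omega)
  have h2' : 2 ≤ n t s := hsymm t s ▸ h2
  have h2z : (2 : ℤ) ≤ n s t := by exact_mod_cast h2
  have := (ih _ (by omega) _ hw₁ rfl t (by rw [hwt]; omega)).2 s h2' (n s t * p - q) p
    (hq.trans hqp) (by nlinarith)
  convert this using 1
  conv_lhs => rw [← hwt, Equiv.Perm.mul_apply]
  congr 1
  rw [hr, pairQ_add_left, pairQ_smul_left, pairQ_smul_left, pairQ_eps_eps, pairQ_eps_eps,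
    aMat_self, aMat_of_ne n hst]
  module

theorem map_eps_nonneg (hr : ∀ (i : I) (α : I → ℤ), r i α = α - pairQ n α (eps i) • eps i)
    (hsymm : ∀ i j, n i j = n j i) {w : Equiv.Perm (I → ℤ)}
    (hw : w ∈ Subgroup.closure (Set.range r)) {s : I}
    (h : wordLength r w ≤ wordLength r (w * r s)) : 0 ≤ w (eps s) :=
  (map_eps_nonneg_aux hr hsymm _ w hw rfl s h).1

theorem map_eps_nonpos (hr : ∀ (i : I) (α : I → ℤ), r i α = α - pairQ n α (eps i) • eps i)
    (hsymm : ∀ i j, n i j = n j i) {w : Equiv.Perm (I → ℤ)}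
    (hw : w ∈ Subgroup.closure (Set.range r)) {s : I}
    (h : wordLength r (w * r s) < wordLength r w) : w (eps s) ≤ 0 := by
  have hws := mul_mem hw (Subgroup.subset_closure (Set.mem_range_self (f := r) s))
  have := map_eps_nonneg hr hsymm hws (s := s)
    (by rw [mul_assoc, reflection_mul_self hr, mul_one]; exact h.le)
  rw [Equiv.Perm.mul_apply, reflection_eps_self hr, map_neg_of_mem_closure hr hw] at this
  exact neg_nonneg.mp this

theorem wordLength_mul_lt_of_map_eps_nonpos
    (hr : ∀ (i : I) (α : I → ℤ), r i α = α - pairQ n α (eps i) • eps i)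
    (hsymm : ∀ i j, n i j = n j i) {w : Equiv.Perm (I → ℤ)}
    (hw : w ∈ Subgroup.closure (Set.range r)) {s : I} (h : w (eps s) ≤ 0) :
    wordLength r (w * r s) < wordLength r w := by
  by_contra! hle
  have h0 : w (eps s) = w 0 := by
    rw [map_zero_of_mem_closure hr hw]
    exact le_antisymm h (map_eps_nonneg hr hsymm hw hle)
  exact eps_ne_zero s (w.injective h0)

theorem exists_map_eps_nonpos
    (hr : ∀ (i : I) (α : I → ℤ), r i α = α - pairQ n α (eps i) • eps i)
    (hsymm : ∀ i j, n i j = n j i) {w : Equiv.Perm (I → ℤ)}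
    (hw : w ∈ Subgroup.closure (Set.range r)) (h1 : w ≠ 1) : ∃ s, w (eps s) ≤ 0 := by
  obtain ⟨s, hs⟩ := exists_wordLength_mul_lt (reflection_mul_self hr) hw h1
  exact ⟨s, map_eps_nonpos hr hsymm hw hs⟩

theorem noncommProd_reflection_apply
    (hr : ∀ (i : I) (α : I → ℤ), r i α = α - pairQ n α (eps i) • eps i) (T : Finset I)
    (hT : ∀ i ∈ T, ∀ j ∈ T, n i j = 0)
    (hcomm : (T : Set I).Pairwise fun a b => Commute (r a) (r b)) (α : I → ℤ) :
    T.noncommProd r hcomm α = α - ∑ i ∈ T, pairQ n α (eps i) • eps i := by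
  induction T using Finset.induction_on with
  | empty => simp
  | insert a T ha ih =>
    rw [Finset.noncommProd_insert_of_notMem _ _ _ _ ha, Equiv.Perm.mul_apply,
      ih fun i hi j hj => hT i (mem_insert_of_mem hi) j (mem_insert_of_mem hj), hr,
      pairQ_sub_left, pairQ_sum_left, Finset.sum_insert ha,
      Finset.sum_eq_zero (f := fun i => pairQ n (pairQ n α (eps i) • eps i) (eps a))]
    · module
    · intro i hi
      rw [pairQ_smul_left, pairQ_eps_eps, aMat_of_ne n (ne_of_mem_of_not_mem hi ha),
        hT i (mem_insert_of_mem hi) a (mem_insert_self a T)]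
      simp

theorem wordLength_mul_noncommProd_le
    (hr : ∀ (i : I) (α : I → ℤ), r i α = α - pairQ n α (eps i) • eps i)
    (hsymm : ∀ i j, n i j = n j i) (T : Finset I)
    (hT : ∀ i ∈ T, ∀ j ∈ T, n i j = 0)
    (hcomm : (T : Set I).Pairwise fun a b => Commute (r a) (r b)) {w : Equiv.Perm (I → ℤ)}
    (hw : w ∈ Subgroup.closure (Set.range r)) (hneg : ∀ i ∈ T, w (eps i) ≤ 0) :
    wordLength r (w * T.noncommProd r hcomm) + T.card ≤ wordLength r w := by
  induction T using Finset.induction_on generalizing w with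
  | empty => simp
  | insert a T ha ih =>
    rw [Finset.noncommProd_insert_of_notMem _ _ _ _ ha, Finset.card_insert_of_notMem ha,
      ← mul_assoc]
    have hlt := wordLength_mul_lt_of_map_eps_nonpos hr hsymm hw
      (hneg a (mem_insert_self a T))
    have := ih (fun i hi j hj => hT i (mem_insert_of_mem hi) j (mem_insert_of_mem hj))
      (hcomm.mono (by simp))
      (mul_mem hw (Subgroup.subset_closure (Set.mem_range_self (f := r) a))) (by
        intro i hi
        rw [Equiv.Perm.mul_apply, reflection_eps_of_ne hr (ne_of_mem_of_not_mem hi ha),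
          hT i (mem_insert_of_mem hi) a (mem_insert_self a T)]
        simpa using hneg i (mem_insert_of_mem hi))
    omega

end SimpleReflections

section Folding

variable {G : Type} [Group G] {I : Type} [MulAction G I] {τ : G →* Equiv.Perm (I → ℤ)}

theorem apply_gact_of_mem_centralizer (hτ : ∀ (g : G) (α : I → ℤ), τ g α = gact G g α)
    {w : Equiv.Perm (I → ℤ)} (hw : w ∈ Subgroup.centralizer (Set.range fun g : G => τ g)) (g : G)
    (α : I → ℤ) : gact G g (w α) = w (gact G g α) := by
  have := congrArg (fun p : Equiv.Perm (I → ℤ) => p α)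
    (Subgroup.mem_centralizer_iff.mp hw (τ g) ⟨g, rfl⟩)
  simpa [hτ] using this

variable [DecidableEq I] {n : I → I → ℕ}

theorem gact_eps (g : G) (i : I) : gact G g (eps i) = eps (g • i) := by
  ext j
  simp [gact, eps, Pi.single_apply, inv_smul_eq_iff]

theorem aMat_smul_smul (hinv : ∀ (g : G) (i j : I), n (g • i) (g • j) = n i j)
    (g : G) (i j : I) : aMat n (g • i) (g • j) = aMat n i j := by
  simp [aMat, hinv]

theorem pairQ_gact_eps [Fintype I] (hinv : ∀ (g : G) (i j : I), n (g • i) (g • j) = n i j) (g : G)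
    (α : I → ℤ) (i : I) : pairQ n (gact G g α) (eps (g • i)) = pairQ n α (eps i) := by
  rw [pairQ_eps, pairQ_eps, ← Equiv.sum_comp (MulAction.toPerm g)]
  simp [gact, aMat_smul_smul hinv]

variable [Fintype G]

theorem mem_orbitF {i j : I} : j ∈ orbitF G i ↔ ∃ g : G, g • i = j := by
  simp [orbitF]

theorem self_mem_orbitF (i : I) : i ∈ orbitF G i := mem_orbitF.mpr ⟨1, one_smul G i⟩

theorem smul_mem_orbitF_iff (g : G) {i j : I} : g • j ∈ orbitF G i ↔ j ∈ orbitF G i := by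
  simp only [mem_orbitF]
  constructor
  · rintro ⟨h, hh⟩
    exact ⟨g⁻¹ * h, by rw [mul_smul, hh, inv_smul_smul]⟩
  · rintro ⟨h, rfl⟩
    exact ⟨g * h, mul_smul _ _ _⟩

theorem eq_zero_of_mem_orbitF (hadm : ∀ i j : I, j ∈ orbitF G i → n i j = 0)
    {a i j : I} (hi : i ∈ orbitF G a) (hj : j ∈ orbitF G a) : n i j = 0 := by
  obtain ⟨g, rfl⟩ := mem_orbitF.mp hi
  obtain ⟨h, rfl⟩ := mem_orbitF.mp hj
  exact hadm _ _ (mem_orbitF.mpr ⟨h * g⁻¹, by rw [← mul_smul, inv_mul_cancel_right]⟩)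

theorem map_eps_nonpos_of_mem_orbitF (hτ : ∀ (g : G) (α : I → ℤ), τ g α = gact G g α)
    {w : Equiv.Perm (I → ℤ)} (hw : w ∈ Subgroup.centralizer (Set.range fun g : G => τ g)) {a i j : I}
    (hi : i ∈ orbitF G a) (hj : j ∈ orbitF G a) (h : w (eps i) ≤ 0) : w (eps j) ≤ 0 := by
  obtain ⟨g, rfl⟩ := mem_orbitF.mp hi
  obtain ⟨g', rfl⟩ := mem_orbitF.mp hj
  have hg : g' • a = (g' * g⁻¹) • g • a := by rw [← mul_smul, inv_mul_cancel_right]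
  rw [hg, ← gact_eps, ← apply_gact_of_mem_centralizer hτ hw]
  exact fun l => h _

variable {ι : Type} {rep : ι → I} {κ : I → ι}

theorem fold_smul (hκ : ∀ i k, i ∈ orbitF G (rep k) ↔ κ i = k) (g : G) (i : I) :
    κ (g • i) = κ i := by
  rw [← hκ, smul_mem_orbitF_iff, hκ]

theorem fold_rep (hκ : ∀ i k, i ∈ orbitF G (rep k) ↔ κ i = k) (k : ι) : κ (rep k) = k :=
  (hκ _ _).mp (self_mem_orbitF _)

theorem fmap_comp_fold (hκ : ∀ i k, i ∈ orbitF G (rep k) ↔ κ i = k) (x : ι → ℤ) :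
    fmap rep (x ∘ κ) = x := by
  ext k
  simp [fmap, fold_rep hκ]

theorem gact_comp_fold (hκ : ∀ i k, i ∈ orbitF G (rep k) ↔ κ i = k) (g : G) (x : ι → ℤ) :
    gact G g (x ∘ κ) = x ∘ κ := by
  ext i
  simp [gact, fold_smul hκ]

theorem fmap_comp_fold_of_invariant (hκ : ∀ i k, i ∈ orbitF G (rep k) ↔ κ i = k) {α : I → ℤ}
    (hα : ∀ g : G, gact G g α = α) : fmap rep α ∘ κ = α := by
  ext i
  obtain ⟨g, hg⟩ := mem_orbitF.mp ((hκ i (κ i)).mpr rfl)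
  have := congrFun (hα g) i
  rw [← this]
  simp only [gact, Function.comp_apply, fmap]
  rw [eq_inv_smul_iff.mpr hg]

theorem apply_comp_fold_invariant (hτ : ∀ (g : G) (α : I → ℤ), τ g α = gact G g α)
    (hκ : ∀ i k, i ∈ orbitF G (rep k) ↔ κ i = k)
    {w : Equiv.Perm (I → ℤ)} (hw : w ∈ Subgroup.centralizer (Set.range fun g : G => τ g))
    (x : ι → ℤ) : fmap rep (w (x ∘ κ)) ∘ κ = w (x ∘ κ) :=
  fmap_comp_fold_of_invariant hκ fun g => by
    rw [apply_gact_of_mem_centralizer hτ hw, gact_comp_fold hκ]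

/-- The action of a permutation of `ℤI` commuting with `G` on the `G`-invariants, which are
identified with `ℤ𝓘`. -/
def restrictInvariants (hτ : ∀ (g : G) (α : I → ℤ), τ g α = gact G g α)
    (hκ : ∀ i k, i ∈ orbitF G (rep k) ↔ κ i = k) :
    Subgroup.centralizer (Set.range fun g : G => τ g) →* Equiv.Perm (ι → ℤ) where
  toFun w :=
    { toFun x := fmap rep (w.1 (x ∘ κ))
      invFun x := fmap rep ((w⁻¹).1 (x ∘ κ))
      left_inv x := by
        dsimp only
        rw [apply_comp_fold_invariant hτ hκ w.2]
        simp [fmap_comp_fold hκ]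
      right_inv x := by
        dsimp only
        rw [apply_comp_fold_invariant hτ hκ (w⁻¹).2]
        simp [fmap_comp_fold hκ] }
  map_one' := by
    ext1 x
    simp [fmap_comp_fold hκ]
  map_mul' w w' := by
    ext1 x
    simp [apply_comp_fold_invariant hτ hκ w'.2]

theorem bMat_eq_sum_aMat [DecidableEq ι] (hκ : ∀ i k, i ∈ orbitF G (rep k) ↔ κ i = k)
    (hadm : ∀ i j : I, j ∈ orbitF G i → n i j = 0) (k l : ι) :
    bMat G n rep k l = ∑ i ∈ orbitF G (rep k), ∑ j ∈ orbitF G (rep l), aMat n i j := by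
  rw [bMat]
  split_ifs with h
  · subst h
    have hrow : ∀ i ∈ orbitF G (rep k), ∑ j ∈ orbitF G (rep k), aMat n i j = 2 := by
      intro i hi
      rw [Finset.sum_eq_single_of_mem i hi, aMat_self]
      intro j hj hji
      rw [aMat_of_ne n hji.symm, eq_zero_of_mem_orbitF hadm hi hj]
      simp
    rw [Finset.sum_congr rfl hrow, Finset.sum_const, dOrb]
    simp [mul_comm]
  · simp only [← Finset.sum_neg_distrib]
    refine Finset.sum_congr rfl fun i hi => Finset.sum_congr rfl fun j hj => ?_
    rw [aMat_of_ne]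
    rintro rfl
    exact h (((hκ i k).mp hi).symm.trans ((hκ i l).mp hj))

variable [Fintype I] {r : I → Equiv.Perm (I → ℤ)}

theorem orbit_noncommProd_apply
    (hr : ∀ (i : I) (α : I → ℤ), r i α = α - pairQ n α (eps i) • eps i)
    (hadm : ∀ i j : I, j ∈ orbitF G i → n i j = 0) (a : I)
    (hcomm : (orbitF G a : Set I).Pairwise fun a b => Commute (r a) (r b)) (α : I → ℤ) (j : I) :
    (orbitF G a).noncommProd r hcomm α j =
      if j ∈ orbitF G a then α j - pairQ n α (eps j) else α j := by
  rw [noncommProd_reflection_apply hr _ fun i hi j hj => eq_zero_of_mem_orbitF hadm hi hj]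
  simp only [Pi.sub_apply, Finset.sum_apply, Pi.smul_apply, eps, Pi.single_apply, smul_eq_mul,
    mul_ite, mul_one, mul_zero, Finset.sum_ite_eq]
  split_ifs <;> simp

theorem orbit_noncommProd_gact
    (hr : ∀ (i : I) (α : I → ℤ), r i α = α - pairQ n α (eps i) • eps i)
    (hadm : ∀ i j : I, j ∈ orbitF G i → n i j = 0)
    (hinv : ∀ (g : G) (i j : I), n (g • i) (g • j) = n i j) (a : I)
    (hcomm : (orbitF G a : Set I).Pairwise fun a b => Commute (r a) (r b)) (g : G) (α : I → ℤ) :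
    (orbitF G a).noncommProd r hcomm (gact G g α) =
      gact G g ((orbitF G a).noncommProd r hcomm α) := by
  ext j
  have hj : j = g • g⁻¹ • j := (smul_inv_smul g j).symm
  have hpair := pairQ_gact_eps hinv g α (g⁻¹ • j)
  rw [smul_inv_smul] at hpair
  rw [orbit_noncommProd_apply hr hadm]
  conv_rhs => rw [gact, orbit_noncommProd_apply hr hadm]
  simp only [smul_mem_orbitF_iff, hpair, gact]

theorem orbit_noncommProd_mem
    (hr : ∀ (i : I) (α : I → ℤ), r i α = α - pairQ n α (eps i) • eps i)
    (hadm : ∀ i j : I, j ∈ orbitF G i → n i j = 0)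
    (hinv : ∀ (g : G) (i j : I), n (g • i) (g • j) = n i j)
    (hτ : ∀ (g : G) (α : I → ℤ), τ g α = gact G g α) (a : I)
    (hcomm : (orbitF G a : Set I).Pairwise fun a b => Commute (r a) (r b)) :
    (orbitF G a).noncommProd r hcomm ∈
      Subgroup.closure (Set.range r) ⊓ Subgroup.centralizer (Set.range fun g : G => τ g) := by
  refine ⟨Subgroup.noncommProd_mem _ _ fun i _ => Subgroup.subset_closure ⟨i, rfl⟩, ?_⟩
  refine Subgroup.mem_centralizer_iff.mpr ?_
  rintro _ ⟨g, rfl⟩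
  ext1 α
  simp [hτ, orbit_noncommProd_gact hr hadm hinv]

theorem eq_one_of_map_comp_fold [DecidableEq ι]
    (hr : ∀ (i : I) (α : I → ℤ), r i α = α - pairQ n α (eps i) • eps i)
    (hsymm : ∀ i j, n i j = n j i)
    (hτ : ∀ (g : G) (α : I → ℤ), τ g α = gact G g α)
    (hκ : ∀ i k, i ∈ orbitF G (rep k) ↔ κ i = k) {w : Equiv.Perm (I → ℤ)}
    (hw : w ∈ Subgroup.closure (Set.range r))
    (hwc : w ∈ Subgroup.centralizer (Set.range fun g : G => τ g))
    (hfix : ∀ x : ι → ℤ, w (x ∘ κ) = x ∘ κ) : w = 1 := by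
  by_contra h1
  obtain ⟨s, hs⟩ := exists_map_eps_nonpos hr hsymm hw h1
  have hsum : (eps (κ s) : ι → ℤ) ∘ κ = ∑ i ∈ orbitF G (rep (κ s)), eps i := by
    ext j
    simp [eps, Pi.single_apply, hκ]
  have hle : w ((eps (κ s) : ι → ℤ) ∘ κ) ≤ 0 := by
    rw [hsum, map_sum_of_mem_closure hr hw]
    exact Finset.sum_nonpos fun i hi =>
      map_eps_nonpos_of_mem_orbitF hτ hwc ((hκ s _).mpr rfl) hi hs
  rw [hfix] at hle
  have := hle s
  simp [eps] at this

theorem restrictInvariants_mem_closure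
    (hr : ∀ (i : I) (α : I → ℤ), r i α = α - pairQ n α (eps i) • eps i)
    (hsymm : ∀ i j, n i j = n j i) (hadm : ∀ i j : I, j ∈ orbitF G i → n i j = 0)
    (hinv : ∀ (g : G) (i j : I), n (g • i) (g • j) = n i j)
    (hτ : ∀ (g : G) (α : I → ℤ), τ g α = gact G g α)
    (hκ : ∀ i k, i ∈ orbitF G (rep k) ↔ κ i = k) {rg : ι → Equiv.Perm (ι → ℤ)}
    (hcomm : ∀ k, (orbitF G (rep k) : Set I).Pairwise fun a b => Commute (r a) (r b))
    (hrg : ∀ k, ∀ h, restrictInvariants hτ hκ ⟨(orbitF G (rep k)).noncommProd r (hcomm k), h⟩ = rg k)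
    (N : ℕ) : ∀ w (_ : w ∈ Subgroup.closure (Set.range r))
    (hwc : w ∈ Subgroup.centralizer (Set.range fun g : G => τ g)), wordLength r w = N →
    restrictInvariants hτ hκ ⟨w, hwc⟩ ∈ Subgroup.closure (Set.range rg) := by
  have : ∀ i, n i i = 0 := fun i => hadm i i (self_mem_orbitF i)
  induction N using Nat.strong_induction_on with
  | _ N ih =>
  intro w hw hwc hN
  by_cases h1 : w = 1
  · subst h1
    exact (map_one (restrictInvariants hτ hκ)).symm ▸ one_mem _
  obtain ⟨s, hs⟩ := exists_map_eps_nonpos hr hsymm hw h1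
  obtain ⟨hS, hSc⟩ := orbit_noncommProd_mem hr hadm hinv hτ _ (hcomm (κ s))
  have hlen := wordLength_mul_noncommProd_le hr hsymm (orbitF G (rep (κ s)))
    (fun i hi j hj => eq_zero_of_mem_orbitF hadm hi hj) (hcomm (κ s)) hw
    (fun i hi => map_eps_nonpos_of_mem_orbitF hτ hwc ((hκ s _).mpr rfl) hi hs)
  have hcard : 0 < (orbitF G (rep (κ s))).card :=
    Finset.card_pos.mpr ⟨s, (hκ s (κ s)).mpr rfl⟩
  have hprod := ih _ (by omega) _ (mul_mem hw hS) (mul_mem hwc hSc) rfl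
  have hmul := (restrictInvariants hτ hκ).map_mul ⟨w, hwc⟩ ⟨_, hSc⟩
  rw [hrg] at hmul
  rw [← MulMemClass.mk_mul_mk _ w _ hwc hSc, hmul] at hprod
  exact (Subgroup.mul_mem_cancel_right _ (Subgroup.subset_closure (Set.mem_range_self (κ s)))).mp hprod

variable [Fintype ι] [DecidableEq ι]

theorem pairV_bMat_eps (hκ : ∀ i k, i ∈ orbitF G (rep k) ↔ κ i = k)
    (hadm : ∀ i j : I, j ∈ orbitF G i → n i j = 0)
    (hinv : ∀ (g : G) (i j : I), n (g • i) (g • j) = n i j) (x : ι → ℤ) (k : ι) :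
    pairV (bMat G n rep) x (eps k) =
      dOrb G (rep k) * pairQ n (x ∘ κ) (eps (rep k)) := by
  have hconst : ∀ i ∈ orbitF G (rep k),
      pairQ n (x ∘ κ) (eps i) = pairQ n (x ∘ κ) (eps (rep k)) := by
    intro i hi
    obtain ⟨g, rfl⟩ := mem_orbitF.mp hi
    rw [← pairQ_gact_eps hinv g _ (rep k), gact_comp_fold hκ]
  have hfiber : ∀ l, orbitF G (rep l) = Finset.univ.filter fun j => κ j = l := by
    intro l
    ext j
    simp [hκ]
  calc pairV (bMat G n rep) x (eps k) = ∑ l, bMat G n rep l k * x l := by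
        simp [pairV, eps, Pi.single_apply]
    _ = ∑ l, ∑ j ∈ orbitF G (rep l), ∑ i ∈ orbitF G (rep k), aMat n j i * x (κ j) := by
        refine Finset.sum_congr rfl fun l _ => ?_
        rw [bMat_eq_sum_aMat hκ hadm, Finset.sum_mul]
        refine Finset.sum_congr rfl fun j hj => ?_
        rw [Finset.sum_mul, (hκ j l).mp hj]
    _ = ∑ j, ∑ i ∈ orbitF G (rep k), aMat n j i * x (κ j) := by
        simp only [hfiber]
        exact Finset.sum_fiberwise _ κ _
    _ = ∑ i ∈ orbitF G (rep k), pairQ n (x ∘ κ) (eps i) := by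
        rw [Finset.sum_comm]
        simp only [pairQ_eps, Function.comp_apply]
    _ = _ := by
        rw [Finset.sum_congr rfl hconst, Finset.sum_const, dOrb, nsmul_eq_mul]

theorem fmap_orbit_noncommProd
    (hr : ∀ (i : I) (α : I → ℤ), r i α = α - pairQ n α (eps i) • eps i)
    (hκ : ∀ i k, i ∈ orbitF G (rep k) ↔ κ i = k)
    (hadm : ∀ i j : I, j ∈ orbitF G i → n i j = 0)
    (hinv : ∀ (g : G) (i j : I), n (g • i) (g • j) = n i j) (k : ι)
    (hcomm : (orbitF G (rep k) : Set I).Pairwise fun a b => Commute (r a) (r b)) (x : ι → ℤ) :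
    fmap rep ((orbitF G (rep k)).noncommProd r hcomm (x ∘ κ)) = gammaRef G n rep k x := by
  have hd : (dOrb G (rep k) : ℤ) ≠ 0 := by
    exact_mod_cast Finset.card_ne_zero_of_mem (self_mem_orbitF (G := G) (rep k))
  ext l
  rw [fmap, orbit_noncommProd_apply hr hadm, gammaRef, pairV_bMat_eps hκ hadm hinv,
    Int.mul_ediv_cancel_left _ hd]
  simp only [hκ, fold_rep hκ]
  by_cases h : l = k
  · subst h
    simp [eps, fold_rep hκ]
  · simp [eps, h, fold_rep hκ]

end Folding

/-- Let `Q` be a finite loopless quiver with an admissible action of a finite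
group `G` and `Γ` the valued graph of `(Q, G)`.  Let `r i` (resp. `rg k`) be the simple
reflections of `W(Q)` (resp. of `W(Γ)`), realized as permutations of the respective root
lattices, let `τ g` realize the `G`-action on `ℤI`, and let
`S k = ∏_{i' ∈ 𝒪_{rep k}} r_{i'}`.  Then `γ_k ↦ S_k` induces a group isomorphism
`W(Γ) ≃* C_G(W(Q)) = W(Q) ⊓ centralizer (G-action)`. -/
theorem statement2
    (G : Type) [Group G] [Fintype G]
    {I : Type} [Fintype I] [DecidableEq I] [MulAction G I]
    {ι : Type} [Fintype ι] [DecidableEq ι]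
    (n : I → I → ℕ) (rep : ι → I)
    (hsymm : ∀ i j, n i j = n j i)
    (hadm : ∀ i j : I, j ∈ orbitF G i → n i j = 0)
    (hinv : ∀ (g : G) (i j : I), n (g • i) (g • j) = n i j)
    (hrep : ∀ i : I, ∃! k : ι, i ∈ orbitF G (rep k))
    (r : I → Equiv.Perm (I → ℤ))
    (hr : ∀ (i : I) (α : I → ℤ), r i α = α - pairQ n α (eps i) • eps i)
    (rg : ι → Equiv.Perm (ι → ℤ))
    (hrg : ∀ (k : ι) (x : ι → ℤ), rg k x = gammaRef G n rep k x)
    (τ : G →* Equiv.Perm (I → ℤ))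
    (hτ : ∀ (g : G) (α : I → ℤ), τ g α = gact G g α)
    (hcomm : ∀ k : ι,
      (↑(orbitF G (rep k)) : Set I).Pairwise fun a b => Commute (r a) (r b)) :
    ∃ Φ : (Subgroup.closure (Set.range rg)) ≃*
        ((Subgroup.closure (Set.range r) ⊓
          Subgroup.centralizer (Set.range fun g : G => τ g) :
            Subgroup (Equiv.Perm (I → ℤ)))),
      ∀ k : ι,
        ((Φ ⟨rg k, Subgroup.subset_closure ⟨k, rfl⟩⟩ : _) : Equiv.Perm (I → ℤ)) =
          (orbitF G (rep k)).noncommProd r (hcomm k) := by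
  choose κ hκmem hκuniq using hrep
  have hκ : ∀ i k, i ∈ orbitF G (rep k) ↔ κ i = k := fun i k =>
    ⟨fun h => (hκuniq i k h).symm, fun h => h ▸ hκmem i⟩
  have : ∀ i, n i i = 0 := fun i => hadm i i (self_mem_orbitF i)
  have hS : ∀ k, ∀ h,
      restrictInvariants hτ hκ ⟨(orbitF G (rep k)).noncommProd r (hcomm k), h⟩ = rg k := by
    intro k h
    ext1 x
    rw [hrg]
    exact fmap_orbit_noncommProd hr hκ hadm hinv k (hcomm k) x
  let ρ := (restrictInvariants hτ hκ).comp (Subgroup.inclusion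
    (inf_le_right : Subgroup.closure (Set.range r) ⊓
      Subgroup.centralizer (Set.range fun g : G => τ g) ≤ _))
  have hρ : Function.Injective ρ := by
    refine (injective_iff_map_eq_one ρ).mpr fun w hw => Subtype.ext ?_
    refine eq_one_of_map_comp_fold hr hsymm hτ hκ w.2.1 w.2.2 fun x => ?_
    rw [← apply_comp_fold_invariant hτ hκ w.2.2]
    exact congrArg (fun p : Equiv.Perm (ι → ℤ) => p x ∘ κ) hw
  have hrange : Subgroup.closure (Set.range rg) = ρ.range := by
    refine le_antisymm ((Subgroup.closure_le _).mpr ?_) ?_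
    · rintro _ ⟨k, rfl⟩
      exact ⟨⟨_, orbit_noncommProd_mem hr hadm hinv hτ _ (hcomm k)⟩, hS k _⟩
    · rintro _ ⟨w, rfl⟩
      exact restrictInvariants_mem_closure hr hsymm hadm hinv hτ hκ hcomm hS _ w.1 w.2.1 w.2.2 rfl
  refine ⟨(MulEquiv.subgroupCongr hrange).trans (MonoidHom.ofInjective hρ).symm, fun k => ?_⟩
  have hk : (MulEquiv.subgroupCongr hrange).trans (MonoidHom.ofInjective hρ).symm
      ⟨rg k, Subgroup.subset_closure ⟨k, rfl⟩⟩ =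
      ⟨_, orbit_noncommProd_mem hr hadm hinv hτ _ (hcomm k)⟩ := by
    rw [MulEquiv.trans_apply, MulEquiv.symm_apply_eq]
    exact Subtype.ext (hS k _).symm
  rw [hk]
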